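/- (a) The connected component 𝒜⁰ of 0 in 𝒜 is a linear subspace of ℝ^m. (b) Setting 𝒱 = ℝ^d × 𝒜⁰ ⊆ ℝ^n, the intersection ℒ ∩ 𝒱 is a full-rank lattice in 𝒱, i.e. a discrete additive subgroup of 𝒱 spanning 𝒱. -/

import Mathlib

noncomputable section
open MeasureTheory Topology Filter Set

namespace LorentzGas

section LatticeProjection

variable {E F : Type*} [NormedAddCommGroup E] [NormedSpace ℝ E]
  [NormedAddCommGroup F] [NormedSpace ℝ F]

/-- The largest linear subspace contained in an additive subgroup of a real vector space. -/
def maximalSubspace (A : AddSubgroup E) : Submodule ℝ E where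
  carrier := {v | ∀ t : ℝ, t • v ∈ A}
  add_mem' hv hw t := by rw [smul_add]; exact A.add_mem (hv t) (hw t)
  zero_mem' t := by rw [smul_zero]; exact A.zero_mem
  smul_mem' c v hv t := by rw [smul_smul]; exact hv (t * c)

theorem mem_of_mem_maximalSubspace {A : AddSubgroup E} {v : E} (hv : v ∈ maximalSubspace A) :
    v ∈ A := by
  simpa using hv 1

/-- A closed subgroup containing no line is discrete. -/
theorem discreteTopology_of_maximalSubspace_eq_bot [FiniteDimensional ℝ E] {A : AddSubgroup E}
    (hA : IsClosed (A : Set E)) (hline : maximalSubspace A = ⊥) : DiscreteTopology A := by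
  suffices h : ∃ ε > 0, ∀ a ∈ A, ‖a‖ < ε → a = 0 by
    obtain ⟨ε, hε, h⟩ := h
    refine discreteTopology_of_isOpen_singleton_zero ?_
    convert! (Metric.isOpen_ball (x := (0 : E)) (ε := ε)).preimage
      (continuous_subtype_val (p := (· ∈ A)))
    ext a
    refine ⟨?_, fun ha => Subtype.ext (h a a.2 (by simpa using ha))⟩
    rintro rfl
    simpa using hε
  by_contra! h
  choose a haA ha_lt ha_ne using fun k : ℕ => h (1 / ((k : ℝ) + 1)) (by positivity)
  have ha_pos k : 0 < ‖a k‖ := norm_pos_iff.2 (ha_ne k)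
  have ha_lim : Tendsto (fun k => ‖a k‖) atTop (𝓝 0) :=
    squeeze_zero (fun k => norm_nonneg _) (fun k => (ha_lt k).le)
      tendsto_one_div_add_atTop_nhds_zero_nat
  obtain ⟨u, hu, φ, hφ, hlim⟩ := (isCompact_sphere (0 : E) 1).tendsto_subseq
    (x := fun k => ‖a k‖⁻¹ • a k) (fun k => by simp [norm_smul, (ha_pos k).ne'])
  have hφ_lim : Tendsto (fun k => ‖a (φ k)‖) atTop (𝓝 0) := ha_lim.comp hφ.tendsto_atTop
  have huline : u ∈ maximalSubspace A := fun t => by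
    have hcoef : Tendsto (fun k => (⌊t / ‖a (φ k)‖⌋ : ℝ) * ‖a (φ k)‖) atTop (𝓝 t) := by
      refine tendsto_of_tendsto_of_tendsto_of_le_of_le (g := fun k => t - ‖a (φ k)‖)
        (h := fun _ => t) (by simpa using hφ_lim.const_sub t) tendsto_const_nhds
        (fun k => ?_) (fun k => ?_)
      · have := Int.sub_one_lt_floor (t / ‖a (φ k)‖)
        have := mul_le_mul_of_nonneg_right this.le (norm_nonneg (a (φ k)))
        rwa [sub_mul, div_mul_cancel₀ _ (ha_pos _).ne', one_mul] at this
      · have := mul_le_mul_of_nonneg_right (Int.floor_le (t / ‖a (φ k)‖)) (norm_nonneg (a (φ k)))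
        rwa [div_mul_cancel₀ _ (ha_pos _).ne'] at this
    refine hA.mem_of_tendsto (hcoef.smul hlim) (Eventually.of_forall fun k => ?_)
    have : ((⌊t / ‖a (φ k)‖⌋ : ℝ) * ‖a (φ k)‖) • ‖a (φ k)‖⁻¹ • a (φ k)
        = ⌊t / ‖a (φ k)‖⌋ • a (φ k) := by
      rw [smul_smul, mul_assoc, mul_inv_cancel₀ (ha_pos _).ne', mul_one, Int.cast_smul_eq_zsmul]
    simpa [this] using A.zsmul_mem (haA (φ k)) ⌊t / ‖a (φ k)‖⌋
  rw [hline, Submodule.mem_bot] at huline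
  simp [huline] at hu

/-- A closed subgroup becomes discrete after dividing by its maximal linear subspace. -/
theorem discreteTopology_map_mkQ_maximalSubspace [FiniteDimensional ℝ E] {A : AddSubgroup E}
    (hA : IsClosed (A : Set E)) [IsClosed (maximalSubspace A : Set E)] :
    DiscreteTopology (A.map (maximalSubspace A).mkQ.toAddMonoidHom) := by
  have mem_iff (v : E) :
      (maximalSubspace A).mkQ v ∈ A.map (maximalSubspace A).mkQ.toAddMonoidHom ↔ v ∈ A := by
    refine ⟨?_, fun hv => ⟨v, hv, rfl⟩⟩
    rintro ⟨w, hw, hwv⟩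
    have := mem_of_mem_maximalSubspace ((Submodule.Quotient.eq _).1 hwv)
    simpa using A.sub_mem hw this
  refine discreteTopology_of_maximalSubspace_eq_bot ?_ ?_
  · rw [← (maximalSubspace A).isQuotientMap_mkQ.isClosed_preimage]
    convert! hA
    ext v
    exact mem_iff v
  · rw [eq_bot_iff]
    intro x hx
    obtain ⟨v, rfl⟩ := (maximalSubspace A).mkQ_surjective x
    rw [Submodule.mem_bot, Submodule.mkQ_apply, Submodule.Quotient.mk_eq_zero]
    intro t
    rw [← mem_iff, map_smul]
    exact hx t

/-- The identity component of a closed subgroup is its maximal linear subspace. -/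
theorem connectedComponentIn_zero_eq_maximalSubspace [FiniteDimensional ℝ E] {A : AddSubgroup E}
    (hA : IsClosed (A : Set E)) :
    connectedComponentIn (A : Set E) 0 = maximalSubspace A := by
  have : IsClosed (maximalSubspace A : Set E) := Submodule.closed_of_finiteDimensional _
  have := discreteTopology_map_mkQ_maximalSubspace hA
  refine subset_antisymm (fun v hv => ?_) ?_
  · have hconn := (isPreconnected_connectedComponentIn (x := 0) (F := (A : Set E))).image
      (maximalSubspace A).mkQ (maximalSubspace A).isQuotientMap_mkQ.continuous.continuousOn
    have htd : IsTotallyDisconnected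
        (A.map (maximalSubspace A).mkQ.toAddMonoidHom : Set (E ⧸ maximalSubspace A)) :=
      totallyDisconnectedSpace_subtype_iff.1
        (inferInstanceAs (TotallyDisconnectedSpace (A.map (maximalSubspace A).mkQ.toAddMonoidHom)))
    have := htd _ (image_mono (connectedComponentIn_subset _ _)) hconn (mem_image_of_mem _ hv)
      (mem_image_of_mem _ (mem_connectedComponentIn A.zero_mem))
    simpa using this
  · exact (maximalSubspace A).convex.isPreconnected.subset_connectedComponentIn
      (zero_mem _) fun v => mem_of_mem_maximalSubspace

/-- The real span of a discrete subgroup has dimension equal to the rank of the subgroup. -/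
theorem finrank_span_of_discreteTopology [FiniteDimensional ℝ E] (L : Submodule ℤ E)
    [DiscreteTopology L] :
    Module.finrank ℝ (Submodule.span ℝ (L : Set E)) = Module.finrank ℤ L := by
  have := Real.finrank_eq_int_finrank_of_discrete (s := (L : Set E)) (by rwa [Submodule.span_eq])
  rwa [Set.finrank, Set.finrank, Submodule.span_eq] at this

/-- A lattice whose image under a linear map is discrete meets the kernel in a lattice. -/
theorem span_inter_ker_eq_ker [FiniteDimensional ℝ E] [FiniteDimensional ℝ F]
    (L : Submodule ℤ E) [DiscreteTopology L] (hL : Submodule.span ℝ (L : Set E) = ⊤)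
    (f : E →ₗ[ℝ] F) [DiscreteTopology (L.map (f.restrictScalars ℤ))] :
    Submodule.span ℝ ((L : Set E) ∩ f.ker) = f.ker := by
  let K : Submodule ℤ E := L ⊓ f.ker.restrictScalars ℤ
  have : DiscreteTopology K := DiscreteTopology.of_subset ‹DiscreteTopology L› inf_le_left
  change Submodule.span ℝ (K : Set E) = f.ker
  refine Submodule.eq_of_le_of_finrank_eq (Submodule.span_le.2 fun x hx => hx.2) ?_
  let g := (f.restrictScalars ℤ).domRestrict L
  have hker : Module.finrank ℤ g.ker = Module.finrank ℤ K := by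
    have h : g.ker.map L.subtype = K := by
      ext x
      simp [g, K, and_comm]
    rw [← h]
    exact (g.ker.equivMapOfInjective L.subtype L.injective_subtype).finrank_eq
  have hrange : g.range = L.map (f.restrictScalars ℤ) := LinearMap.range_domRestrict _ _
  have hint := g.ker.finrank_quotient_add_finrank
  rw [g.quotKerEquivRange.finrank_eq, hrange, hker, ← finrank_span_of_discreteTopology,
    ← finrank_span_of_discreteTopology, ← finrank_span_of_discreteTopology L, hL, finrank_top,
    Submodule.map_coe] at hint
  have hreal := f.finrank_range_add_finrank_ker
  have himage : Submodule.span ℝ (f.restrictScalars ℤ '' (L : Set E)) = f.range := by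
    rw [LinearMap.coe_restrictScalars, Submodule.span_image, hL, Submodule.map_top]
  rw [himage] at hint
  lia

end LatticeProjection

/-- for a full-rank lattice ℒ ⊂ ℝ^n = ℝ^d × ℝ^m with
𝒜 = closure(π_int(ℒ)): (a) the connected component 𝒜⁰ of 0 in 𝒜 is a linear
subspace of ℝ^m; (b) with 𝒱 = ℝ^d × 𝒜⁰, the intersection ℒ ∩ 𝒱 is a (discrete
additive subgroup and) full-rank lattice in 𝒱, i.e. it spans 𝒱. -/
theorem statement16 (d m : ℕ) (hd : 1 ≤ d) (hm : 1 ≤ m)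
    (L : AddSubgroup ((Fin d → ℝ) × (Fin m → ℝ)))
    (hLdisc : DiscreteTopology L)
    (hLspan : Submodule.span ℝ (L : Set ((Fin d → ℝ) × (Fin m → ℝ))) = ⊤) :
    -- (a)
    (∃ p : Submodule ℝ (Fin m → ℝ),
      (p : Set (Fin m → ℝ))
        = connectedComponentIn (closure (Prod.snd '' (L : Set ((Fin d → ℝ) × (Fin m → ℝ))))) 0) ∧
    -- (b)
    ((∃ L' : AddSubgroup ((Fin d → ℝ) × (Fin m → ℝ)),
        (L' : Set ((Fin d → ℝ) × (Fin m → ℝ)))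
          = (L : Set ((Fin d → ℝ) × (Fin m → ℝ))) ∩
            {p | p.2 ∈ connectedComponentIn
              (closure (Prod.snd '' (L : Set ((Fin d → ℝ) × (Fin m → ℝ))))) 0}) ∧
      DiscreteTopology
        (((L : Set ((Fin d → ℝ) × (Fin m → ℝ))) ∩
          {p | p.2 ∈ connectedComponentIn
            (closure (Prod.snd '' (L : Set ((Fin d → ℝ) × (Fin m → ℝ))))) 0} :
          Set ((Fin d → ℝ) × (Fin m → ℝ)))) ∧
      Submodule.span ℝ
          ((L : Set ((Fin d → ℝ) × (Fin m → ℝ))) ∩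
            {p | p.2 ∈ connectedComponentIn
              (closure (Prod.snd '' (L : Set ((Fin d → ℝ) × (Fin m → ℝ))))) 0})
        = Submodule.span ℝ
            {p : (Fin d → ℝ) × (Fin m → ℝ) | p.2 ∈ connectedComponentIn
              (closure (Prod.snd '' (L : Set ((Fin d → ℝ) × (Fin m → ℝ))))) 0}) := by
  let π := (LinearMap.snd ℝ (Fin d → ℝ) (Fin m → ℝ)).toAddMonoidHom
  let A := (L.map π).topologicalClosure
  have hA : IsClosed (A : Set (Fin m → ℝ)) := AddSubgroup.isClosed_topologicalClosure _
  have hcomp : connectedComponentIn (closure (Prod.snd '' (L : Set ((Fin d → ℝ) × (Fin m → ℝ))))) 0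
      = maximalSubspace A := connectedComponentIn_zero_eq_maximalSubspace hA
  rw [hcomp]
  have : IsClosed (maximalSubspace A : Set (Fin m → ℝ)) := Submodule.closed_of_finiteDimensional _
  let f := (maximalSubspace A).mkQ ∘ₗ LinearMap.snd ℝ (Fin d → ℝ) (Fin m → ℝ)
  have hker : {p : (Fin d → ℝ) × (Fin m → ℝ) | p.2 ∈ (maximalSubspace A : Set (Fin m → ℝ))}
      = (f.ker : Set ((Fin d → ℝ) × (Fin m → ℝ))) := by
    ext p
    simp [f]
  rw [hker]
  refine ⟨⟨_, rfl⟩, ⟨L ⊓ f.ker.toAddSubgroup, rfl⟩,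
    DiscreteTopology.of_subset hLdisc inter_subset_left, ?_⟩
  have : DiscreteTopology (AddSubgroup.toIntSubmodule L) := hLdisc
  have : DiscreteTopology ((AddSubgroup.toIntSubmodule L).map (f.restrictScalars ℤ)) := by
    refine DiscreteTopology.of_subset (discreteTopology_map_mkQ_maximalSubspace hA) ?_
    rintro _ ⟨x, hx, rfl⟩
    exact ⟨x.2, AddSubgroup.le_topologicalClosure _ ⟨x, hx, rfl⟩, rfl⟩
  rw [Submodule.span_eq]
  exact span_inter_ker_eq_ker (AddSubgroup.toIntSubmodule L) hLspan f

end LorentzGas
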